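/- arXiv:2012.08030 — 4 statements merged into one kernel-verified Lean document; each statement's English description precedes it below -/
import Mathlib

section
/- Fix an integer n ≥ 3. The adjacent-swap Markov chain on the labeled constrained ordered matchings COM^L_n is irreducible: for any two states x, y ∈ COM^L_n there exists t ≥ 0 with (P^L)^t(x,y) > 0. -/
open Finset

/-- Labels for a labeled constrained ordered matching of order `n`:
`Sum.inl i` is the leaf label `ℓ_{i+1}`, and `Sum.inr j` is the internal label `j+1`. -/
abbrev LLabel (n : ℕ) := Fin n ⊕ Fin (n - 2)

/-- `p` is a labeled constrained ordered matching: the pairs `p 0, …, p (n-2)`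
(0-indexed versions of `p_1, …, p_{n-1}`) have size two, partition the label set,
and the internal label `j+1` (i.e. `Sum.inr j`) may only appear in pair `p_k`
(1-indexed pair `k+1`) when `j + 1 < k + 1`. -/
def IsLCOM (n : ℕ) (p : Fin (n - 1) → Finset (LLabel n)) : Prop :=
  (∀ k, (p k).card = 2) ∧
  (∀ a : LLabel n, ∃ k, a ∈ p k ∧ ∀ k', a ∈ p k' → k' = k) ∧
  (∀ (j : Fin (n - 2)) (k : Fin (n - 1)), Sum.inr j ∈ p k → (j : ℕ) < (k : ℕ))

instance (n : ℕ) : DecidablePred (IsLCOM n) := fun _ => by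
  unfold IsLCOM; infer_instance

/-- The set of labeled constrained ordered matchings `COM^L_n`. -/
abbrev LCOM (n : ℕ) : Type := {p : Fin (n - 1) → Finset (LLabel n) // IsLCOM n p}

/-- Index of the pair `p_k` (1-indexed `k ∈ {1,…,n-2}`) as an element of `Fin (n-1)`. -/
def idx1 {n : ℕ} (k : Fin (n - 2)) : Fin (n - 1) := ⟨k, by have := k.isLt; omega⟩

/-- Index of the pair `p_{k+1}` as an element of `Fin (n-1)`. -/
def idx2 {n : ℕ} (k : Fin (n - 2)) : Fin (n - 1) := ⟨(k : ℕ) + 1, by have := k.isLt; omega⟩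

/-- Result of exchanging label `l1` from pair `k` with label `l2` from pair `k+1`. -/
def lswapFun (n : ℕ) (p : Fin (n - 1) → Finset (LLabel n)) (k : Fin (n - 2))
    (l1 l2 : LLabel n) : Fin (n - 1) → Finset (LLabel n) :=
  fun i =>
    if i = idx1 k then insert l2 ((p (idx1 k)).erase l1)
    else if i = idx2 k then insert l1 ((p (idx2 k)).erase l2)
    else p i

/-- The state obtained from `x` when attempting to exchange `l1 ∈ p_k` with `l2 ∈ p_{k+1}`:
the swap is performed if it yields a valid constrained ordered matching,
otherwise the chain stays at `x`. -/
def lswapDest (n : ℕ) (x : LCOM n) (k : Fin (n - 2)) (l1 l2 : LLabel n) :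
    Fin (n - 1) → Finset (LLabel n) :=
  if IsLCOM n (lswapFun n x.val k l1 l2) then lswapFun n x.val k l1 l2 else x.val

/-- Transition matrix of the adjacent-swap Markov chain on `COM^L_n`:
pick `k ∈ {1,…,n-2}` uniformly, pick `l1` uniformly from the two elements of `p_k`
and `l2` uniformly from the two elements of `p_{k+1}`, and swap them if allowed. -/
noncomputable def PL (n : ℕ) (x y : LCOM n) : ℝ :=
  (1 / ((n : ℝ) - 2)) * ∑ k : Fin (n - 2), ∑ l1 ∈ x.val (idx1 k), ∑ l2 ∈ x.val (idx2 k),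
    (1 / 4 : ℝ) * (if lswapDest n x k l1 l2 = y.val then 1 else 0)

/-- The adjacent-swap transition matrix on `COM^L_n` as a matrix. -/
noncomputable def PLmat (n : ℕ) : Matrix (LCOM n) (LCOM n) ℝ := Matrix.of (PL n)

theorem exists_pos {n : ℕ} (x : LCOM n) :
    ∃ X : LLabel n → Fin (n - 1), ∀ c k, c ∈ x.val k ↔ X c = k := by
  choose X h1 h2 using x.2.2.1
  refine ⟨X, fun c k => ⟨fun h => (h2 c k h).symm, ?_⟩⟩
  rintro rfl
  exact h1 c

theorem PL_nonneg {n : ℕ} (hn : 3 ≤ n) (x y : LCOM n) : 0 ≤ PL n x y := by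
  have h3 : (3 : ℝ) ≤ n := by exact_mod_cast hn
  unfold PL
  refine mul_nonneg (by apply one_div_nonneg.2; linarith) ?_
  refine Finset.sum_nonneg fun k _ => Finset.sum_nonneg fun l _ => Finset.sum_nonneg fun m _ => ?_
  split_ifs <;> norm_num

theorem PL_pos {n : ℕ} (hn : 3 ≤ n) (x y : LCOM n) (k : Fin (n - 2)) (b a : LLabel n)
    (hb : b ∈ x.val (idx1 k)) (ha : a ∈ x.val (idx2 k))
    (h : lswapFun n x.val k b a = y.val) : 0 < PL n x y := by
  have h3 : (3 : ℝ) ≤ n := by exact_mod_cast hn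
  have hd : lswapDest n x k b a = y.val := by
    unfold lswapDest
    rw [h, if_pos y.2]
  unfold PL
  refine mul_pos (by apply one_div_pos.2; linarith) ?_
  have h0 : ∀ k l m, (0 : ℝ) ≤ (1 / 4 : ℝ) * (if lswapDest n x k l m = y.val then 1 else 0) := by
    intro k l m
    split_ifs <;> norm_num
  refine Finset.sum_pos' (fun k _ => Finset.sum_nonneg fun l _ => Finset.sum_nonneg fun m _ => h0 _ _ _)
    ⟨k, Finset.mem_univ _, ?_⟩
  refine Finset.sum_pos' (fun l _ => Finset.sum_nonneg fun m _ => h0 _ _ _) ⟨b, hb, ?_⟩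
  refine Finset.sum_pos' (fun m _ => h0 _ _ _) ⟨a, ha, ?_⟩
  rw [if_pos hd]; norm_num

theorem pow_nonneg' {n : ℕ} (hn : 3 ≤ n) (t : ℕ) : ∀ x y, 0 ≤ (PLmat n ^ t) x y := by
  induction t with
  | zero =>
    intro x y
    rw [pow_zero, Matrix.one_apply]
    split_ifs <;> norm_num
  | succ t ih =>
    intro x y
    rw [pow_succ', Matrix.mul_apply]
    exact Finset.sum_nonneg fun z _ => mul_nonneg (PL_nonneg hn x z) (ih z y)

theorem step_reach {n : ℕ} (hn : 3 ≤ n) (x z y : LCOM n) (h : 0 < PL n x z)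
    (hz : ∃ t : ℕ, 0 < (PLmat n ^ t) z y) : ∃ t : ℕ, 0 < (PLmat n ^ t) x y := by
  obtain ⟨t, ht⟩ := hz
  refine ⟨t + 1, ?_⟩
  rw [pow_succ', Matrix.mul_apply]
  exact Finset.sum_pos' (fun w _ => mul_nonneg (PL_nonneg hn x w) (pow_nonneg' hn t w y))
    ⟨z, Finset.mem_univ _, mul_pos h ht⟩

theorem find_swap {n : ℕ} (x y : LCOM n) (X Y : LLabel n → Fin (n - 1))
    (hX : ∀ c k, c ∈ x.val k ↔ X c = k) (hY : ∀ c k, c ∈ y.val k ↔ Y c = k) (hne : x ≠ y) :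
    ∃ (k : Fin (n - 2)) (b a : LLabel n), X b = idx1 k ∧ X a = idx2 k ∧
      Y a < Y b ∧ (Y a : ℕ) ≤ k := by
  classical
  have hex : (Finset.univ.filter fun k => x.val k ≠ y.val k).Nonempty := by
    by_contra h
    rw [Finset.not_nonempty_iff_eq_empty, Finset.filter_eq_empty_iff] at h
    apply hne
    apply Subtype.ext
    funext k
    have := h (Finset.mem_univ k)
    simpa using this
  obtain ⟨k, hk, hmin⟩ := Finset.exists_min_image _ id hex
  have hk' : x.val k ≠ y.val k := (Finset.mem_filter.1 hk).2
  have hlt : ∀ j, j < k → x.val j = y.val j := by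
    intro j hj
    by_contra h
    have := hmin j (Finset.mem_filter.2 ⟨Finset.mem_univ _, h⟩)
    exact absurd hj (not_lt.2 this)
  have key : ∀ c, Y c < k → X c = Y c := by
    intro c hc
    rw [← hX, hlt _ hc, hY]
  have key2 : ∀ c, X c < k → Y c = X c := by
    intro c hc
    rw [← hY, ← hlt _ hc, hX]
  have hns : ¬ y.val k ⊆ x.val k := by
    intro h
    exact hk' (Finset.eq_of_subset_of_card_le h (by rw [x.2.1, y.2.1])).symm
  obtain ⟨a, hay, hax⟩ := Finset.not_subset.1 hns
  rw [hY] at hay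
  rw [hX] at hax
  have hgt : k < X a := by
    rcases lt_trichotomy (X a) k with h | h | h
    · exact absurd (key2 a h) (by rw [hay]; exact ne_of_gt h)
    · exact absurd h hax
    · exact h
  have hgt' : (k : ℕ) < X a := hgt
  have hXlt := (X a).isLt
  let i : Fin (n - 2) := ⟨(X a : ℕ) - 1, by omega⟩
  have hi2 : X a = idx2 i := by
    apply Fin.ext
    simp only [idx2, i]
    omega
  have hns2 : ¬ x.val (idx1 i) ⊆ y.val k := by
    intro h
    have he := Finset.eq_of_subset_of_card_le h (by rw [x.2.1, y.2.1])
    have h1 : a ∈ x.val (idx1 i) := by rw [he, hY, hay]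
    rw [hX, hi2] at h1
    have := congrArg Fin.val h1
    simp [idx1, idx2] at this
  obtain ⟨b, hbx, hby⟩ := Finset.not_subset.1 hns2
  rw [hX] at hbx
  rw [hY] at hby
  refine ⟨i, b, a, hbx, hi2, ?_, ?_⟩
  · rw [hay]
    rcases lt_trichotomy (Y b) k with h | h | h
    · have h1 := key b h
      have h2 : (Y b : ℕ) < k := h
      rw [← h1, hbx] at h2
      simp only [idx1, i] at h2
      omega
    · exact absurd h hby
    · exact h
  · rw [hay]
    simp only [i]
    omega

theorem idx_ne {n : ℕ} (k : Fin (n - 2)) : idx1 k ≠ idx2 k := by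
  intro h
  have := congrArg Fin.val h
  simp [idx1, idx2] at this

theorem swap_mem {n : ℕ} (x : LCOM n) (X : LLabel n → Fin (n - 1))
    (hX : ∀ c k, c ∈ x.val k ↔ X c = k) (k : Fin (n - 2)) (b a : LLabel n)
    (hb : X b = idx1 k) (ha : X a = idx2 k) (c : LLabel n) (i : Fin (n - 1)) :
    c ∈ lswapFun n x.val k b a i ↔
      (if c = a then idx1 k else if c = b then idx2 k else X c) = i := by
  have h12 := idx_ne k
  have hab : a ≠ b := by
    rintro rfl
    exact h12 (hb.symm.trans ha)
  unfold lswapFun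
  grind

theorem swap_valid {n : ℕ} (x : LCOM n) (X : LLabel n → Fin (n - 1))
    (hX : ∀ c k, c ∈ x.val k ↔ X c = k) (k : Fin (n - 2)) (b a : LLabel n)
    (hb : X b = idx1 k) (ha : X a = idx2 k)
    (hv : ∀ j : Fin (n - 2), a = Sum.inr j → (j : ℕ) < k) :
    IsLCOM n (lswapFun n x.val k b a) := by
  have hm := swap_mem x X hX k b a hb ha
  have h12 := idx_ne k
  have hab : a ≠ b := by
    rintro rfl
    exact h12 (hb.symm.trans ha)
  refine ⟨?_, ?_, ?_⟩
  · intro i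
    have hc := x.2.1
    unfold lswapFun
    split_ifs with h1 h2
    · rw [Finset.card_insert_of_notMem, Finset.card_erase_of_mem, hc]
      · rw [hX, hb]
      · rw [Finset.mem_erase, hX, ha]
        exact fun h => h12 h.2.symm
    · rw [Finset.card_insert_of_notMem, Finset.card_erase_of_mem, hc]
      · rw [hX, ha]
      · rw [Finset.mem_erase, hX, hb]
        exact fun h => h12 h.2
    · exact hc i
  · intro c
    exact ⟨_, (hm c _).2 rfl, fun k' h => ((hm c k').1 h).symm⟩
  · intro j i h
    rw [hm] at h
    split_ifs at h with h1 h2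
    · rw [← h]
      exact hv j h1.symm
    · have := x.2.2.2 j (idx1 k) (by rw [hX, h2, hb])
      rw [← h]
      simp only [idx1, idx2] at *
      omega
    · exact x.2.2.2 j i (by rw [hX, h])

theorem main_ind {n : ℕ} (hn : 3 ≤ n) (y : LCOM n) (Y : LLabel n → Fin (n - 1))
    (hY : ∀ c k, c ∈ y.val k ↔ Y c = k) (N : ℕ) :
    ∀ (x : LCOM n) (X : LLabel n → Fin (n - 1)), (∀ c k, c ∈ x.val k ↔ X c = k) →
      (∑ c, ((n : ℤ) - (X c : ℕ)) * (Y c : ℕ) < N) → ∃ t : ℕ, 0 < (PLmat n ^ t) x y := by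
  induction N with
  | zero =>
    intro x X _ h
    exfalso
    refine absurd h (not_lt.2 ?_)
    refine Finset.sum_nonneg fun c _ => mul_nonneg ?_ (by positivity)
    have := (X c).isLt
    omega
  | succ N ih =>
    intro x X hX h
    by_cases hxy : x = y
    · subst hxy
      exact ⟨0, by rw [pow_zero, Matrix.one_apply_eq]; norm_num⟩
    obtain ⟨k, b, a, hb, ha, hlt, hle⟩ := find_swap x y X Y hX hY hxy
    have hv : IsLCOM n (lswapFun n x.val k b a) := by
      refine swap_valid x X hX k b a hb ha ?_
      rintro j rfl
      have := y.2.2.2 j (Y (Sum.inr j)) ((hY _ _).2 rfl)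
      omega
    refine step_reach hn x ⟨_, hv⟩ y
      (PL_pos hn x _ k b a ((hX _ _).2 hb) ((hX _ _).2 ha) rfl) ?_
    refine ih ⟨_, hv⟩ _ (swap_mem x X hX k b a hb ha) ?_
    have hab : a ≠ b := by
      rintro rfl
      exact lt_irrefl _ hlt
    have e : ∀ c, ((n : ℤ) - (((if c = a then idx1 k else if c = b then idx2 k else X c) : Fin (n - 1)) : ℕ)) * (Y c : ℕ)
        = ((n : ℤ) - (X c : ℕ)) * (Y c : ℕ) + (if c = a then ((Y a : ℕ) : ℤ) else 0)
          - (if c = b then ((Y b : ℕ) : ℤ) else 0) := by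
      intro c
      by_cases h1 : c = a
      · subst h1
        rw [if_pos rfl, if_pos rfl, if_neg hab, ha]
        simp only [idx1, idx2]
        push_cast
        ring
      · by_cases h2 : c = b
        · subst h2
          rw [if_neg h1, if_pos rfl, if_neg h1, if_pos rfl, hb]
          simp only [idx1, idx2]
          push_cast
          ring
        · simp [h1, h2]
    rw [Finset.sum_congr rfl fun c _ => e c, Finset.sum_sub_distrib, Finset.sum_add_distrib,
      Finset.sum_ite_eq' , Finset.sum_ite_eq', if_pos (Finset.mem_univ _),
      if_pos (Finset.mem_univ _)]
    have hlt' : (Y a : ℕ) < Y b := hlt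
    push_cast at h
    omega

/-- For `n ≥ 3`, the adjacent-swap Markov chain on `COM^L_n` is irreducible:
for any two states `x, y` there exists `t ≥ 0` with `(P^L)^t(x,y) > 0`. -/
theorem stmt2 (n : ℕ) (hn : 3 ≤ n) (x y : LCOM n) :
    ∃ t : ℕ, 0 < (PLmat n ^ t) x y := by
  obtain ⟨X, hX⟩ := exists_pos x
  obtain ⟨Y, hY⟩ := exists_pos y
  refine main_ind hn y Y hY ((∑ c, ((n : ℤ) - (X c : ℕ)) * (Y c : ℕ)).toNat + 1) x X hX ?_
  have := Int.self_le_toNat (∑ c, ((n : ℤ) - (X c : ℕ)) * (Y c : ℕ))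
  push_cast at this ⊢
  omega
end

section
/- Fix an integer n ≥ 3. The Tajima distribution is a probability distribution on the unlabeled constrained ordered matchings: ∑_{T ∈ COM_n} 2^{n−c(T)−1} = (n−1)!. -/
open Finset

/-- `p` is an unlabeled constrained ordered matching: each `p k` is a multiset of size two
over the symbols `Fin (n-1)` (symbol `0` stands for a leaf, symbol `j ≠ 0` for the internal
label `j`); across all pairs the symbol `0` appears `n` times and each internal label once;
and the internal label `j` may only appear in pair `p k` (1-indexed pair `k+1`) when 
`j < k + 1`, i.e. `j ≤ k`. -/
def IsUCOMraw (n : ℕ) (p : Fin (n - 1) → Multiset (Fin (n - 1))) : Prop :=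
  (∀ k, Multiset.card (p k) = 2) ∧
  (∀ s : Fin (n - 1), (∑ k, (p k).count s) = if (s : ℕ) = 0 then n else 1) ∧
  (∀ (j k : Fin (n - 1)), (j : ℕ) ≠ 0 → j ∈ p k → (j : ℕ) ≤ (k : ℕ))

instance (n : ℕ) : DecidablePred (IsUCOMraw n) := fun _ => by
  unfold IsUCOMraw; infer_instance

instance (n : ℕ) :
    DecidablePred (fun p : Fin (n - 1) → Sym (Fin (n - 1)) 2 =>
      IsUCOMraw n (fun k => (p k : Multiset (Fin (n - 1))))) := fun _ => by
  infer_instance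

/-- The set of unlabeled constrained ordered matchings `COM_n`; each pair is stored as an
unordered pair with possible repetition (`Sym _ 2`), with the validity predicate imposed on
the underlying multisets. -/
abbrev UCOM (n : ℕ) : Type :=
  {p : Fin (n - 1) → Sym (Fin (n - 1)) 2 //
    IsUCOMraw n (fun k => (p k : Multiset (Fin (n - 1))))}

/-- The sequence of size-two multisets underlying an unlabeled constrained ordered matching. -/
def uraw (n : ℕ) (x : UCOM n) : Fin (n - 1) → Multiset (Fin (n - 1)) :=
  fun k => (x.val k : Multiset (Fin (n - 1)))

/-- Result of exchanging symbol `l1` from pair `k` with symbol `l2` from pair `k+1`. -/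
def uswapFun (n : ℕ) (p : Fin (n - 1) → Multiset (Fin (n - 1))) (k : Fin (n - 2))
    (l1 l2 : Fin (n - 1)) : Fin (n - 1) → Multiset (Fin (n - 1)) :=
  fun i =>
    if i = idx1 k then l2 ::ₘ (p (idx1 k)).erase l1
    else if i = idx2 k then l1 ::ₘ (p (idx2 k)).erase l2
    else p i

/-- The state obtained from `x` when attempting to exchange `l1 ∈ p_k` with `l2 ∈ p_{k+1}`:
the swap is performed if it yields a valid constrained ordered matching,
otherwise the chain stays at `x`. -/
def uswapDest (n : ℕ) (x : UCOM n) (k : Fin (n - 2)) (l1 l2 : Fin (n - 1)) :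
    Fin (n - 1) → Multiset (Fin (n - 1)) :=
  if IsUCOMraw n (uswapFun n (uraw n x) k l1 l2) then uswapFun n (uraw n x) k l1 l2
  else uraw n x

/-- Transition matrix of the adjacent-swap Markov chain on `COM_n`:
pick `k ∈ {1,…,n-2}` uniformly, pick `l1` uniformly from the multiset `p_k`
and `l2` uniformly from the multiset `p_{k+1}` (each of the two slots of a pair
with probability 1/2), and swap them if allowed. -/
noncomputable def PU (n : ℕ) (x y : UCOM n) : ℝ :=
  (1 / ((n : ℝ) - 2)) * ∑ k : Fin (n - 2),
    ((uraw n x (idx1 k)).map (fun l1 =>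
      ((uraw n x (idx2 k)).map (fun l2 =>
        (1 / 4 : ℝ) * (if uswapDest n x k l1 l2 = uraw n y then 1 else 0))).sum)).sum

/-- The adjacent-swap transition matrix on `COM_n` as a matrix. -/
noncomputable def PUmat (n : ℕ) : Matrix (UCOM n) (UCOM n) ℝ := Matrix.of (PU n)

/-- The number of cherries of `T`: pairs all of whose elements are the leaf symbol `0`,
i.e. pairs equal to `{0,0}`. -/
def cherries (n : ℕ) (T : UCOM n) : ℕ :=
  (Finset.univ.filter (fun k : Fin (n - 1) => ∀ a ∈ uraw n T k, (a : ℕ) = 0)).card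

/-- The Tajima coalescent distribution on `COM_n`. -/
noncomputable def tajima (n : ℕ) (T : UCOM n) : ℝ :=
  (2 : ℝ) ^ (n - cherries n T - 1) / (Nat.factorial (n - 1))

/-- The (1-indexed, shifted down by one) index of the pair containing the internal label `j`:
`Ix n x j` is the unique `k` (0-indexed) with `j ∈ p_{k+1}`, so that `I_x(j) = Ix n x j + 1`. -/
noncomputable def Ix (n : ℕ) (x : UCOM n) (j : Fin (n - 1)) : ℕ :=
  sInf {k : ℕ | ∃ h : k < n - 1, j ∈ uraw n x ⟨k, h⟩}

/-- The internal tree length `φ(x) = ∑_{j=1}^{n-2} (I_x(j) - j)`. -/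
noncomputable def itl (n : ℕ) (x : UCOM n) : ℤ :=
  ∑ j ∈ Finset.univ.filter (fun j : Fin (n - 1) => (j : ℕ) ≠ 0),
    ((Ix n x j : ℤ) + 1 - (j : ℤ))


theorem count_inj {α : Type*} [Fintype α] [DecidableEq α] (A : ℕ → Finset α)
    (hA : Monotone A) (N : ℕ) :
    (univ.filter (fun g : Fin N → α => Function.Injective g ∧ ∀ i : Fin N, g i ∈ A i)).card
      = ∏ i ∈ range N, ((A i).card - i) := by
  induction N with
  | zero =>
    simp [Function.injective_of_subsingleton]
  | succ N ih =>
    rw [prod_range_succ, ← ih]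
    rw [Finset.card_eq_sum_card_fiberwise (f := fun g : Fin (N+1) → α => (Fin.init g : Fin N → α))
      (t := univ.filter (fun g : Fin N → α => Function.Injective g ∧ ∀ i : Fin N, g i ∈ A i))]
    · rw [Finset.sum_const_nat (m := (A N).card - N)]
      intro g hg
      simp only [mem_filter, mem_univ, true_and] at hg
      have h1 : (A N \ univ.image g).card = (A N).card - N := by
        rw [card_sdiff_of_subset, card_image_of_injective _ hg.1, card_univ, Fintype.card_fin]
        intro x hx
        simp only [mem_image, mem_univ, true_and] at hx
        obtain ⟨i, rfl⟩ := hx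
        exact hA (le_of_lt i.2) (hg.2 i)
      rw [← h1]
      symm
      apply Finset.card_bij (fun a _ => (Fin.snoc g a : Fin (N+1) → α))
      · intro a ha
        simp only [mem_sdiff, mem_image, mem_univ, true_and, not_exists] at ha
        simp only [mem_filter, mem_univ, true_and, Fin.init_snoc, and_true]
        refine ⟨?_, ?_⟩
        · rw [Fin.snoc_injective_iff]
          exact ⟨hg.1, by rintro ⟨i, hi⟩; exact ha.2 i hi⟩
        · intro i
          refine Fin.lastCases ?_ (fun i => ?_) i
          · simpa using ha.1
          · simpa using hg.2 i
      · intro a _ b _ h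
        have := congrFun h (Fin.last N)
        simpa using this
      · intro f hf
        simp only [mem_filter, mem_univ, true_and] at hf
        obtain ⟨⟨hi, hm⟩, rfl⟩ := hf
        refine ⟨f (Fin.last N), ?_, Fin.snoc_init_self f⟩
        simp only [mem_sdiff, mem_image, mem_univ, true_and, not_exists]
        refine ⟨by simpa using hm (Fin.last N), fun i h => ?_⟩
        have := hi h
        exact absurd this (Fin.castSucc_lt_last i).ne
    · intro g hg
      simp only [coe_filter, mem_univ, true_and, Set.mem_ofPred_eq] at hg ⊢
      refine ⟨fun a b h => ?_, fun i => by simpa [Fin.init] using hg.2 i.castSucc⟩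
      exact Fin.castSucc_injective _ (hg.1 h)

def slotVal {m : ℕ} (q : Fin m → Fin m × Fin m) (x : Fin m × Bool) : Fin m :=
  if x.2 then (q x.1).1 else (q x.1).2

def pairMs {m : ℕ} (q : Fin m → Fin m × Fin m) (k : Fin m) : Multiset (Fin m) :=
  {(q k).1, (q k).2}

theorem sum_count {m : ℕ} (q : Fin m → Fin m × Fin m) (s : Fin m) :
    ∑ k, (pairMs q k).count s = (univ.filter (fun x => slotVal q x = s)).card := by
  rw [card_filter, Fintype.sum_prod_type]
  refine sum_congr rfl fun k _ => ?_
  simp only [slotVal, pairMs, Multiset.insert_eq_cons, Multiset.count_cons, Multiset.count_singleton,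
    Fintype.sum_bool, eq_comm (a := s)]
  simp [add_comm]

theorem mem_pairMs {m : ℕ} (q : Fin m → Fin m × Fin m) (s k : Fin m) :
    s ∈ pairMs q k ↔ ∃ b, slotVal q (k, b) = s := by
  simp [slotVal, pairMs, eq_comm, or_comm]

theorem fib_card {α : Type*} [Fintype α] [DecidableEq α] (s : Sym α 2)
    [Decidable (∃ x, (s : Multiset α) = {x, x})] :
    (univ.filter (fun ab : α × α => ({ab.1, ab.2} : Multiset α) = (s : Multiset α))).card
     = if ∃ x, (s : Multiset α) = {x, x} then 1 else 2 := by
  obtain ⟨s, hs⟩ := s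
  obtain ⟨x, y, rfl⟩ := Multiset.card_eq_two.1 hs
  have key : ∀ a b c d : α, ({a, b} : Multiset α) = {c, d} ↔ (a = c ∧ b = d) ∨ (a = d ∧ b = c) := by
    intro a b c d
    have := @Sym2.eq_iff α a b c d
    rw [← this]
    change ((([a, b] : List α) : Multiset α) = ([c, d] : List α)) ↔ _
    rw [Multiset.coe_eq_coe, Sym2.eq_iff]
    constructor
    · intro h
      have ha : a ∈ [c, d] := h.subset (by simp)
      have h2 : [b].Perm ([c, d].erase a) := by simpa using h.erase a
      by_cases hac : a = c
      · subst hac; left; simpa using h2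
      · have had : a = d := by simpa [hac] using ha
        subst had; right
        rw [List.erase_cons_tail (by simpa using fun h => hac h.symm)] at h2
        simpa using h2
    · rintro (⟨rfl, rfl⟩ | ⟨rfl, rfl⟩)
      · rfl
      · exact List.Perm.swap _ _ _
  by_cases h : x = y
  · subst h
    rw [if_pos ⟨x, rfl⟩, card_eq_one]
    refine ⟨(x, x), ?_⟩
    ext ⟨a, b⟩
    rw [mem_filter]
    refine (and_iff_right (mem_univ _)).trans ((key a b x x).trans ?_)
    simp
  · rw [if_neg, card_eq_two]
    · refine ⟨(x, y), (y, x), by simp [h], ?_⟩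
      ext ⟨a, b⟩
      rw [mem_filter]
      refine (and_iff_right (mem_univ _)).trans ((key a b x y).trans ?_)
      simp
    · rintro ⟨z, hz⟩
      have := (key _ _ _ _).1 hz
      grind

def lab {N : ℕ} (i : Fin N) : Fin (N + 1) := ⟨N - i, by omega⟩

theorem lab_inj {N : ℕ} {i j : Fin N} (h : lab i = lab j) : i = j := by
  have := congrArg Fin.val h
  simp only [lab] at this
  ext; omega

theorem lab_ne {N : ℕ} (i : Fin N) : (lab i : ℕ) ≠ 0 := by
  simp only [lab]; omega

theorem lab_surj {N : ℕ} (s : Fin (N + 1)) (hs : (s : ℕ) ≠ 0) : ∃ i : Fin N, lab i = s :=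
  ⟨⟨N - s, by omega⟩, by ext; simp only [lab]; omega⟩

open Classical in
noncomputable def toS {N : ℕ} (g : Fin N → Fin (N + 1) × Bool) (x : Fin (N + 1) × Bool) : Fin (N + 1) :=
  if h : ∃ i, g i = x then lab h.choose else 0

theorem toS_eq {N : ℕ} (g : Fin N → Fin (N + 1) × Bool) (hg : Function.Injective g)
    (x : Fin (N + 1) × Bool) (i : Fin N) : toS g x = lab i ↔ g i = x := by
  unfold toS
  split_ifs with h
  · constructor
    · intro h'
      rw [← lab_inj h']
      exact h.choose_spec
    · intro h'
      rw [hg (h.choose_spec.trans h'.symm)]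
  · constructor
    · intro h'
      exact absurd (congrArg Fin.val h').symm (lab_ne i)
    · intro h'
      exact absurd ⟨i, h'⟩ h

noncomputable def toQ {N : ℕ} (g : Fin N → Fin (N + 1) × Bool) (k : Fin (N + 1)) :
    Fin (N + 1) × Fin (N + 1) := (toS g (k, true), toS g (k, false))

theorem slotVal_toQ {N : ℕ} (g : Fin N → Fin (N + 1) × Bool) (x : Fin (N + 1) × Bool) :
    slotVal (toQ g) x = toS g x := by
  obtain ⟨k, b⟩ := x
  cases b <;> simp [slotVal, toQ]

theorem q_ext {m : ℕ} {q q' : Fin m → Fin m × Fin m} (h : ∀ x, slotVal q x = slotVal q' x) :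
    q = q' := by
  funext k
  have h1 := h (k, true)
  have h2 := h (k, false)
  simp only [slotVal, if_true] at h1 h2
  exact Prod.ext h1 (by simpa using h2)

def AA (N i : ℕ) : Finset (Fin (N + 1) × Bool) := univ.filter (fun x => N - i ≤ (x.1 : ℕ))

theorem AA_card (N i : ℕ) (hi : i < N) : (AA N i).card = 2 * (i + 1) := by
  have : AA N i = (Finset.Ici (⟨N - i, by omega⟩ : Fin (N + 1))) ×ˢ univ := by
    ext ⟨k, b⟩
    simp [AA, Fin.le_def]
  rw [this, card_product, Fin.card_Ici]
  simp
  omega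

instance (N : ℕ) : DecidablePred (fun q : Fin (N + 1) → Fin (N + 1) × Fin (N + 1) =>
   IsUCOMraw (N + 2) (pairMs q)) := fun _ => inferInstance

theorem step2 (N : ℕ) :
    (univ.filter (fun q : Fin (N + 1) → Fin (N + 1) × Fin (N + 1) =>
      IsUCOMraw (N + 2) (pairMs q))).card = (N + 1).factorial := by
  have hcount := count_inj (AA N) (by
    intro i j hij x hx
    simp only [AA, mem_filter, mem_univ, true_and] at hx ⊢
    omega) N
  have hprod : ∏ i ∈ range N, ((AA N i).card - i) = (N + 1).factorial := by
    rw [← Finset.prod_range_add_one_eq_factorial, prod_range_succ']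
    simp only [zero_add, mul_one]
    refine prod_congr rfl fun i hi => ?_
    rw [AA_card N i (by simpa using hi)]
    omega
  rw [← hprod, ← hcount]
  symm
  apply Finset.card_bij (fun g _ => toQ g)
  · intro g hg
    simp only [mem_filter, mem_univ, true_and] at hg ⊢
    obtain ⟨hi, hm⟩ := hg
    have hlab : ∀ s : Fin (N + 1), (s : ℕ) ≠ 0 →
        (univ.filter (fun x => slotVal (toQ g) x = s)).card = 1 := by
      intro s hs
      obtain ⟨i, rfl⟩ := lab_surj s hs
      rw [card_eq_one]
      refine ⟨g i, ?_⟩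
      ext x
      simp [slotVal_toQ, toS_eq g hi, eq_comm]
    refine ⟨fun k => by simp [pairMs], ?_, ?_⟩
    · intro s
      refine (sum_count (toQ g) s).trans ?_
      split_ifs with hs
      · have htot := Finset.card_eq_sum_card_fiberwise (f := slotVal (toQ g)) (s := univ) (t := univ)
          (fun _ _ => by simp)
        rw [Fin.sum_univ_succ] at htot
        rw [sum_congr rfl (fun i _ => hlab (Fin.succ i) (by simp))] at htot
        have : s = (0 : Fin (N + 1)) := Fin.ext hs
        rw [this]
        simp at htot
        omega
      · exact hlab s hs
    · intro j k hj hjk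
      obtain ⟨b, hb⟩ := (mem_pairMs _ _ _).1 hjk
      obtain ⟨i, rfl⟩ := lab_surj j hj
      rw [slotVal_toQ, toS_eq g hi] at hb
      have := hm i
      rw [hb] at this
      simpa [AA, lab] using this
  · intro g hg g' hg' h
    simp only [mem_filter, mem_univ, true_and] at hg hg'
    funext i
    have h1 : toS g (g i) = lab i := (toS_eq g hg.1 _ _).2 rfl
    rw [← slotVal_toQ, h, slotVal_toQ, toS_eq g' hg'.1] at h1
    exact h1.symm
  · intro q hq
    simp only [mem_filter, mem_univ, true_and] at hq
    obtain ⟨_, h2, h3⟩ := hq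
    have h4 : ∀ i : Fin N, ∃ x, (univ.filter (fun x => slotVal q x = lab i)) = {x} := by
      intro i
      rw [← card_eq_one, ← sum_count]
      exact (h2 (lab i)).trans (if_neg (lab_ne i))
    choose g hg using h4
    have hg' : ∀ i x, slotVal q x = lab i ↔ x = g i := by
      intro i x
      have : x ∈ univ.filter (fun x => slotVal q x = lab i) ↔ x = g i := by rw [hg]; simp
      simpa using this
    have hinj : Function.Injective g := by
      intro i j hij
      have h1 := (hg' i _).2 rfl
      rw [hij, (hg' j _).2 rfl] at h1
      exact (lab_inj h1).symm
    refine ⟨g, ?_, ?_⟩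
    · simp only [mem_filter, mem_univ, true_and]
      refine ⟨hinj, fun i => ?_⟩
      have := h3 (lab i) (g i).1 (lab_ne i) ((mem_pairMs _ _ _).2 ⟨(g i).2, (hg' i _).2 rfl⟩)
      simpa [AA, lab] using this
    · apply q_ext
      intro x
      rw [slotVal_toQ]
      by_cases hx : (slotVal q x : ℕ) = 0
      · by_contra hne
        have h5 : (toS g x : ℕ) ≠ 0 := fun h => hne (Fin.ext (h.trans hx.symm))
        obtain ⟨i, hi⟩ := lab_surj _ h5
        have h6 := (hg' i x).2 ((toS_eq g hinj _ _).1 hi.symm).symm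
        rw [h6] at hx
        exact lab_ne i hx
      · obtain ⟨i, hi⟩ := lab_surj _ hx
        rw [← hi, toS_eq g hinj]
        exact ((hg' i x).1 hi.symm).symm

def toP {m : ℕ} (q : Fin m → Fin m × Fin m) (k : Fin m) : Sym (Fin m) 2 :=
  ⟨pairMs q k, by simp [pairMs]⟩

theorem step1 (N : ℕ) :
    ∑ T : UCOM (N + 2), 2 ^ (N + 2 - cherries (N + 2) T - 1) =
    (univ.filter (fun q : Fin (N + 1) → Fin (N + 1) × Fin (N + 1) =>
      IsUCOMraw (N + 2) (pairMs q))).card := by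
  rw [Finset.card_eq_sum_card_fiberwise (f := toP)
    (t := univ.filter (fun p : Fin (N + 1) → Sym (Fin (N + 1)) 2 =>
      IsUCOMraw (N + 2) (fun k => (p k : Multiset (Fin (N + 1))))))]
  · symm
    rw [Finset.sum_subtype (p := fun p : Fin (N + 1) → Sym (Fin (N + 1)) 2 =>
      IsUCOMraw (N + 2) (fun k => (p k : Multiset (Fin (N + 1))))) _ (fun x => by simp)]
    refine Finset.sum_congr rfl ?_
    rintro ⟨p, hp⟩ -
    have h1 : (univ.filter (fun q : Fin (N + 1) → Fin (N + 1) × Fin (N + 1) =>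
        IsUCOMraw (N + 2) (pairMs q))).filter (fun q => toP q = p) =
        Fintype.piFinset (fun k => univ.filter
          (fun ab : Fin (N + 1) × Fin (N + 1) => ({ab.1, ab.2} : Multiset (Fin (N + 1))) = p k)) := by
      ext q
      simp only [mem_filter, mem_univ, true_and, Fintype.mem_piFinset]
      constructor
      · rintro ⟨_, rfl⟩ k
        rfl
      · intro h
        have h' : toP q = p := by
          funext k
          exact Subtype.ext (h k)
        refine ⟨?_, h'⟩
        rw [← h'] at hp
        exact hp
    rw [h1, Fintype.card_piFinset]
    have h2 : ∀ k : Fin (N + 1), (∃ x, (p k : Multiset (Fin (N + 1))) = {x, x}) ↔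
        ∀ a ∈ (p k : Multiset (Fin (N + 1))), (a : ℕ) = 0 := by
      intro k
      constructor
      · rintro ⟨x, hx⟩ a ha
        have : a = x := by rw [hx] at ha; simpa using ha
        subst this
        by_contra h0
        have h3 := hp.2.1 a
        rw [if_neg h0] at h3
        have h4 := Finset.single_le_sum (f := fun k : Fin (N + 1) => ((p k : Multiset (Fin (N + 1)))).count a)
          (fun _ _ => Nat.zero_le _) (mem_univ k)
        have h5 : ((p k : Multiset (Fin (N + 1)))).count a = 2 := by
          rw [hx]; simp [Multiset.insert_eq_cons]
        have h6 : ∑ k : Fin (N + 1), ((p k : Multiset (Fin (N + 1)))).count a = 1 := h3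
        simp only [h6, h5] at h4
        omega
      · intro h
        obtain ⟨x, y, hxy⟩ := Multiset.card_eq_two.1 (p k).2
        have hxy : (p k : Multiset (Fin (N + 1))) = {x, y} := hxy
        rw [hxy] at h ⊢
        have hx : x = 0 := Fin.ext (h x (by simp))
        have hy : y = 0 := Fin.ext (h y (by simp))
        exact ⟨0, by rw [hx, hy]⟩
    rw [prod_congr rfl (fun k _ => fib_card (p k))]
    refine (Finset.prod_ite (s := (univ : Finset (Fin (N + 1))))
      (p := fun k => ∃ x, (p k : Multiset (Fin (N + 1))) = {x, x})
      (fun _ => 1) (fun _ => 2)).trans ?_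
    rw [prod_const_one, one_mul, prod_const]
    congr 1
    have h3 := Finset.card_filter_add_card_filter_not (s := (univ : Finset (Fin (N + 1))))
      (fun k => ∃ x, (p k : Multiset (Fin (N + 1))) = {x, x})
    have h4 : cherries (N + 2) ⟨p, hp⟩ = (univ.filter
       (fun k => ∃ x, (p k : Multiset (Fin (N + 1))) = {x, x})).card := by
      unfold cherries
      refine congrArg Finset.card (Finset.ext fun k => ?_)
      simp only [mem_filter, mem_univ, true_and]
      exact (h2 k).symm
    rw [h4]
    simp only [card_univ, Fintype.card_fin] at h3
    omega
  · intro q hq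
    simp only [coe_filter, mem_univ, true_and, Set.mem_ofPred_eq] at hq ⊢
    exact hq

/-- For `n ≥ 3`, the Tajima distribution is a probability distribution on
`COM_n`: `∑_{T ∈ COM_n} 2^{n−c(T)−1} = (n−1)!`. -/
theorem stmt6 (n : ℕ) (hn : 3 ≤ n) :
    ∑ T : UCOM n, 2 ^ (n - cherries n T - 1) = Nat.factorial (n - 1) := by
  obtain ⟨N, rfl⟩ : ∃ N, n = N + 2 := ⟨n - 2, by omega⟩
  exact (step1 N).trans (step2 N)
end

section
/- Fix an integer n ≥ 3. Let Φ : COM^L_n → COM_n be the projection that replaces every leaf label ℓ_i by the symbol 0. For every unlabeled constrained ordered matching T ∈ COM_n, the number of labeled constrained ordered matchings x ∈ COM^L_n with Φ(x) = T equals n!/2^{c(T)}, where c(T) is the number of cherries of T. Equivalently, the fraction |Φ^{-1}(T)|/|COM^L_n| equals the Tajima probability 2^{n−c(T)−1}/(n−1)!. -/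
open Finset

/-- Projection of labels: every leaf label `ℓ_i` is sent to the symbol `0`, and the
internal label `j` is kept (the internal label coded by `Sum.inr j` has value `j+1`). -/
def projLabel (n : ℕ) (hn : 3 ≤ n) : LLabel n → Fin (n - 1)
  | .inl _ => ⟨0, by omega⟩
  | .inr j => ⟨(j : ℕ) + 1, by have := j.isLt; omega⟩

/-- Projection `Φ` from labeled constrained ordered matchings to sequences of size-two
multisets of symbols, replacing every leaf label by `0`. -/
def projRaw (n : ℕ) (hn : 3 ≤ n) (p : Fin (n - 1) → Finset (LLabel n)) :
    Fin (n - 1) → Multiset (Fin (n - 1)) :=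
  fun k => (p k).val.map (projLabel n hn)


def seqGood {α : Type*} [Fintype α] [DecidableEq α] (m : ℕ) (A : ℕ → Finset α) (s : ℕ → ℕ) :
    Finset (Fin m → Finset α) :=
  Finset.univ.filter (fun p => (∀ k, (p k).card = s k) ∧
    (∀ k k', k ≠ k' → Disjoint (p k) (p k')) ∧ ∀ k, p k ⊆ A k)

theorem seqGood_card {α : Type*} [Fintype α] [DecidableEq α] (A : ℕ → Finset α) (hA : Monotone A)
    (s : ℕ → ℕ) (m : ℕ) :
    (seqGood m A s).card =
      ∏ k ∈ Finset.range m, Nat.choose ((A k).card - ∑ i ∈ Finset.range k, s i) (s k) := by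
  induction m with
  | zero =>
    simp only [Finset.range_zero, Finset.prod_empty]
    rw [Finset.card_eq_one]
    refine ⟨fun k => k.elim0, ?_⟩
    ext p
    simp only [seqGood, Finset.mem_filter, Finset.mem_univ, true_and, Finset.mem_singleton]
    constructor
    · intro _; funext k; exact k.elim0
    · intro _; exact ⟨fun k => k.elim0, fun k => k.elim0, fun k => k.elim0⟩
  | succ m ih =>
    have key : (seqGood (m+1) A s).card = ((seqGood m A s).sigma
        (fun p => Finset.powersetCard (s m) (A m \ Finset.univ.biUnion p))).card := by
      refine Finset.card_nbij' (fun p => ⟨Fin.init p, p (Fin.last m)⟩)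
        (fun x => Fin.snoc (α := fun _ => Finset α) x.1 x.2) ?_ ?_ ?_ ?_
      · intro p hp
        simp only [seqGood, Finset.coe_filter, Finset.mem_univ, true_and, Set.mem_ofPred_eq] at hp
        obtain ⟨h1, h2, h3⟩ := hp
        simp only [Finset.mem_coe, Finset.mem_sigma, seqGood, Finset.mem_filter, Finset.mem_univ,
          true_and, Finset.mem_powersetCard, Finset.subset_sdiff, Finset.disjoint_biUnion_right]
        refine ⟨⟨fun k => ?_, fun k k' hk => h2 _ _ ?_, fun k => ?_⟩, ⟨?_, fun k _ => h2 _ _ ?_⟩, ?_⟩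
        · simpa [Fin.init] using h1 k.castSucc
        · simpa using hk
        · simpa [Fin.init] using h3 k.castSucc
        · simpa using h3 (Fin.last m)
        · exact (Fin.castSucc_lt_last k).ne'
        · simpa using h1 (Fin.last m)
      · rintro ⟨p, t⟩ hp
        simp only [Finset.mem_coe, Finset.mem_sigma, seqGood, Finset.mem_filter, Finset.mem_univ,
          true_and, Finset.mem_powersetCard, Finset.subset_sdiff, Finset.disjoint_biUnion_right] at hp
        obtain ⟨⟨h1, h2, h3⟩, ⟨h4, h5⟩, h6⟩ := hp
        simp only [seqGood, Finset.coe_filter, Finset.mem_univ, true_and, Set.mem_ofPred_eq]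
        refine ⟨fun k => ?_, fun k k' => ?_, fun k => ?_⟩
        · refine Fin.lastCases ?_ (fun i => ?_) k
          · simpa using h6
          · simpa using h1 i
        · refine Fin.lastCases ?_ (fun i => ?_) k <;> refine Fin.lastCases ?_ (fun i' => ?_) k'
          · simp
          · intro _; simpa using h5 i' trivial
          · intro _; simpa using (h5 i trivial).symm
          · intro h; simpa using h2 i i' (by simpa using h)
        · refine Fin.lastCases ?_ (fun i => ?_) k
          · simpa using h4
          · simpa using h3 i
      · intro p _; simp
      · rintro ⟨p, t⟩ _; simp
    rw [key, Finset.card_sigma, Finset.prod_range_succ, ← ih, Finset.sum_const_nat]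
    intro p hp
    simp only [seqGood, Finset.mem_filter, Finset.mem_univ, true_and] at hp
    obtain ⟨h1, h2, h3⟩ := hp
    rw [Finset.card_powersetCard, Finset.card_sdiff_of_subset, Finset.card_biUnion]
    · rw [Finset.sum_range]; simp [h1]
    · intro i _ j _ h; exact h2 i j h
    · exact Finset.biUnion_subset.2 fun k _ => (h3 k).trans (hA k.2.le)

theorem cover_of_card {α : Type*} [Fintype α] [DecidableEq α] {m : ℕ} (p : Fin m → Finset α)
    (hd : ∀ k k', k ≠ k' → Disjoint (p k) (p k')) (hs : ∑ k, (p k).card = Fintype.card α) (a : α) :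
    ∃ k, a ∈ p k ∧ ∀ k', a ∈ p k' → k' = k := by
  have : Finset.univ.biUnion p = Finset.univ := by
    rw [← Finset.card_eq_iff_eq_univ, Finset.card_biUnion, hs]
    intro i _ j _ h; exact hd i j h
  have ha := Finset.mem_univ a
  rw [← this, Finset.mem_biUnion] at ha
  obtain ⟨k, _, hk⟩ := ha
  refine ⟨k, hk, fun k' hk' => ?_⟩
  by_contra h
  exact Finset.disjoint_left.1 (hd _ _ h) hk' hk

theorem disj_of_unique {α : Type*} [DecidableEq α] {m : ℕ} (p : Fin m → Finset α)
    (h : ∀ a, ∃ k, a ∈ p k ∧ ∀ k', a ∈ p k' → k' = k) (k k' : Fin m) (hk : k ≠ k') :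
    Disjoint (p k) (p k') := by
  rw [Finset.disjoint_left]
  intro a h1 h2
  obtain ⟨l, _, hl⟩ := h a
  exact hk ((hl _ h1).trans (hl _ h2).symm)

theorem prod_choose_fact (N : ℕ) (s : ℕ → ℕ) (m : ℕ) (h : ∑ i ∈ Finset.range m, s i ≤ N) :
    (∏ k ∈ Finset.range m, (s k).factorial) *
    (∏ k ∈ Finset.range m, Nat.choose (N - ∑ i ∈ Finset.range k, s i) (s k)) *
      (N - ∑ i ∈ Finset.range m, s i).factorial = N.factorial := by
  induction m with
  | zero => simp
  | succ m ih =>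
    rw [Finset.sum_range_succ] at h ⊢
    rw [Finset.prod_range_succ, Finset.prod_range_succ, ← ih (by omega)]
    have := Nat.choose_mul_factorial_mul_factorial
      (n := N - ∑ i ∈ Finset.range m, s i) (k := s m) (by omega)
    rw [← this, Nat.sub_sub]
    ring

theorem prod_choose_two (n m : ℕ) (h : m < n) :
    2 ^ m * (∏ k ∈ Finset.range m, Nat.choose (n - k) 2) * ((n - m).factorial * (n - 1 - m).factorial)
      = n.factorial * (n-1).factorial := by
  induction m with
  | zero => simp
  | succ m ih =>
    rw [Finset.prod_range_succ, ← ih (by omega)]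
    obtain ⟨d, rfl⟩ : ∃ d, n = m + 1 + 1 + d := ⟨n - m - 2, by omega⟩
    have e1 : m + 1 + 1 + d - m = d + 1 + 1 := by omega
    have e2 : m + 1 + 1 + d - (m + 1) = d + 1 := by omega
    have e3 : m + 1 + 1 + d - 1 - (m + 1) = d := by omega
    have e4 : m + 1 + 1 + d - 1 - m = d + 1 := by omega
    rw [e1, e2, e3, e4]
    have := Nat.choose_two_right (d+1+1)
    have h2 : Nat.choose (d+1+1) 2 * 2 = (d+1+1) * (d+1) := by
      rw [this]; apply Nat.div_mul_cancel
      simpa using (Nat.even_mul_pred_self (d+1+1)).two_dvd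
    simp only [Nat.factorial_succ (d+1), Nat.factorial_succ d, pow_succ]
    linear_combination (2^m * (∏ k ∈ Finset.range m, Nat.choose (m + 1 + 1 + d - k) 2) * ((d+1) * d.factorial * d.factorial)) * h2

/-- available labels -/
def avail (n k : ℕ) : Finset (LLabel n) :=
  (Finset.univ : Finset (Fin n)).disjSum (Finset.univ.filter (fun j : Fin (n-2) => (j:ℕ) < k))

theorem avail_card (n k : ℕ) (h : k ≤ n - 2) : (avail n k).card = n + k := by
  simp only [avail, Finset.card_disjSum, Finset.card_univ, Fintype.card_fin, Fin.card_filter_val_lt]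
  omega

theorem avail_mono (n : ℕ) : Monotone (avail n) := by
  intro a b h
  apply Finset.disjSum_mono_right
  intro j hj
  simp at hj ⊢
  omega

theorem isLCOM_iff (n : ℕ) (hn : 3 ≤ n) (p : Fin (n - 1) → Finset (LLabel n)) :
    IsLCOM n p ↔ p ∈ seqGood (n-1) (avail n) (fun _ => 2) := by
  simp only [seqGood, Finset.mem_filter, Finset.mem_univ, true_and]
  constructor
  · rintro ⟨h1, h2, h3⟩
    refine ⟨h1, disj_of_unique p h2, fun k a ha => ?_⟩
    rcases a with a | j
    · simp [avail]
    · simpa [avail] using h3 j k ha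
  · rintro ⟨h1, h2, h3⟩
    refine ⟨h1, fun a => cover_of_card p h2 ?_ a, fun j k hj => ?_⟩
    · simp [h1]; omega
    · simpa [avail] using h3 k hj

theorem card_LCOM (n : ℕ) (hn : 3 ≤ n) :
    2 ^ (n-1) * Fintype.card (LCOM n) = n.factorial * (n-1).factorial := by
  have h : Fintype.card (LCOM n) = (seqGood (n-1) (avail n) (fun _ => 2)).card := by
    apply Fintype.card_of_subtype
    intro p; exact (isLCOM_iff n hn p).symm
  rw [h, seqGood_card _ (avail_mono n), ← prod_choose_two n (n-1) (by omega)]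
  have : n - (n-1) = 1 := by omega
  simp only [this, Nat.sub_self, Nat.factorial, mul_one]
  rw [Nat.succ_eq_add_one, zero_add, mul_one]
  refine congrArg (fun t => 2 ^ (n-1) * t) ?_
  apply Finset.prod_congr rfl
  intro k hk
  rw [Finset.mem_range] at hk
  rw [avail_card n k (by omega)]
  simp
  congr 1
  omega

def tR (n : ℕ) (T : UCOM n) (k : Fin (n-1)) : Finset (Fin (n-2)) :=
  Finset.univ.filter (fun j => idx2 j ∈ uraw n T k)

def tS (n : ℕ) (T : UCOM n) (k : ℕ) : ℕ :=
  if h : k < n - 1 then (uraw n T ⟨k, h⟩).count ⟨0, by omega⟩ else 0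

theorem count_proj_zero (n : ℕ) (hn : 3 ≤ n) (x : Finset (LLabel n)) (h0 : 0 < n - 1) :
    (x.val.map (projLabel n hn)).count ⟨0, h0⟩ = x.toLeft.card := by
  rw [Multiset.count_map, ← Finset.card_map (Function.Embedding.inl : Fin n ↪ LLabel n)]
  rw [← Finset.filter_val, Finset.card_val]
  congr 1
  ext a
  rw [Finset.mem_filter]
  rcases a with a | j <;> simp [projLabel]

theorem count_proj_succ (n : ℕ) (hn : 3 ≤ n) (x : Finset (LLabel n)) (j : Fin (n-2)) :
    (x.val.map (projLabel n hn)).count (idx2 j) = if j ∈ x.toRight then 1 else 0 := by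
  have : idx2 j = projLabel n hn (Sum.inr j) := rfl
  rw [Multiset.count_map, ← Finset.filter_val, Finset.card_val]
  have : x.filter (fun a => idx2 j = projLabel n hn a) = if j ∈ x.toRight then {Sum.inr j} else ∅ := by
    ext a
    rw [Finset.mem_filter]
    split_ifs with h <;> rcases a with a | i <;> simp [projLabel, idx2] at h ⊢
    · constructor
      · rintro ⟨_, h⟩; exact Fin.ext h.symm
      · rintro rfl; exact ⟨h, rfl⟩
    · intro h1 h2
      have : j = i := Fin.ext h2
      exact h (this ▸ h1)
  rw [this]; split_ifs <;> simp

theorem fin_cases_idx (n : ℕ) (s : Fin (n-1)) : (s : ℕ) = 0 ∨ ∃ j : Fin (n-2), s = idx2 j := by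
  rcases Nat.eq_zero_or_pos (s:ℕ) with h | h
  · exact Or.inl h
  · refine Or.inr ⟨⟨s - 1, by have := s.2; omega⟩, ?_⟩
    apply Fin.ext; simp [idx2]; omega

theorem T_sum_one (n : ℕ) (T : UCOM n) (j : Fin (n-2)) :
    ∑ k, (uraw n T k).count (idx2 j) = 1 := by
  have := T.2.2.1 (idx2 j)
  rw [if_neg (by simp [idx2])] at this
  exact this

theorem T_count_succ (n : ℕ) (T : UCOM n) (j : Fin (n-2)) (k : Fin (n-1)) :
    (uraw n T k).count (idx2 j) = if j ∈ tR n T k then 1 else 0 := by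
  have h1 := T_sum_one n T j
  have h2 : (uraw n T k).count (idx2 j) ≤ 1 := by
    refine le_of_le_of_eq ?_ h1
    exact Finset.single_le_sum (f := fun k => (uraw n T k).count (idx2 j)) (fun _ _ => Nat.zero_le _) (Finset.mem_univ k)
  have h3 : j ∈ tR n T k ↔ 0 < (uraw n T k).count (idx2 j) := by
    simp [tR, Multiset.count_pos]
  split_ifs with h <;> rw [h3] at h <;> omega

theorem T_count_zero (n : ℕ) (T : UCOM n) (k : Fin (n-1)) (h0 : 0 < n - 1) :
    (uraw n T k).count ⟨0, h0⟩ = tS n T k := by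
  simp [tS, k.2]

theorem proj_iff (n : ℕ) (hn : 3 ≤ n) (T : UCOM n) (x : Finset (LLabel n)) (k : Fin (n-1)) :
    x.val.map (projLabel n hn) = uraw n T k ↔ x.toLeft.card = tS n T k ∧ x.toRight = tR n T k := by
  have h0 : 0 < n - 1 := by omega
  rw [Multiset.ext, ← T_count_zero n T k h0, ← count_proj_zero n hn x h0]
  constructor
  · intro h
    refine ⟨h _, ?_⟩
    ext j
    have := h (idx2 j)
    rw [count_proj_succ, T_count_succ] at this
    split_ifs at this <;> tauto
  · rintro ⟨h1, h2⟩ s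
    rcases fin_cases_idx n s with h | ⟨j, rfl⟩
    · have : s = ⟨0, h0⟩ := Fin.ext h
      rw [this, h1]
    · rw [count_proj_succ, T_count_succ, h2]

theorem tS_sum (n : ℕ) (hn : 3 ≤ n) (T : UCOM n) : ∑ k ∈ Finset.range (n-1), tS n T k = n := by
  rw [Finset.sum_range]
  have h0 : 0 < n - 1 := by omega
  have := T.2.2.1 ⟨0, h0⟩
  simp only [if_true] at this
  refine Eq.trans ?_ this
  exact Finset.sum_congr rfl fun k _ => (T_count_zero n T k h0).symm

theorem fiber_card (n : ℕ) (hn : 3 ≤ n) (T : UCOM n) :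
    (Finset.univ.filter (fun x : LCOM n => projRaw n hn x.val = uraw n T)).card
      = (seqGood (α := Fin n) (n-1) (fun _ => Finset.univ) (tS n T)).card := by
  have hP : ∀ x : Fin (n-1) → Finset (LLabel n), projRaw n hn x = uraw n T ↔
      ∀ k, (x k).toLeft.card = tS n T k ∧ (x k).toRight = tR n T k := by
    intro x
    rw [funext_iff]
    exact forall_congr' fun k => proj_iff n hn T (x k) k
  have hL : ∀ q ∈ seqGood (α := Fin n) (n-1) (fun _ => Finset.univ) (tS n T),
      projRaw n hn (fun k => (q k).disjSum (tR n T k)) = uraw n T ∧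
      IsLCOM n (fun k => (q k).disjSum (tR n T k)) := by
    intro q hq
    simp only [seqGood, Finset.mem_filter, Finset.mem_univ, true_and] at hq
    obtain ⟨h1, h2, -⟩ := hq
    have hp : projRaw n hn (fun k => (q k).disjSum (tR n T k)) = uraw n T := by
      rw [hP]; intro k; simp [h1]
    refine ⟨hp, fun k => ?_, fun a => ?_, fun j k hj => ?_⟩
    · have := congrArg Multiset.card (congrFun hp k)
      simp only [projRaw, Multiset.card_map] at this
      rw [← Finset.card_val, this]
      exact T.2.1 k
    · rcases a with a | j
      · obtain ⟨k, hk⟩ := cover_of_card q h2 (by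
          rw [Fintype.card_fin]
          refine Eq.trans ?_ (tS_sum n hn T)
          rw [Finset.sum_range]; exact Finset.sum_congr rfl fun k _ => h1 k) a
        exact ⟨k, by simpa using hk⟩
      · have h := T_sum_one n T j
        simp only [T_count_succ] at h
        rw [Finset.sum_boole] at h
        obtain ⟨k, hk⟩ := Finset.card_eq_one.1 (by simpa using h)
        refine ⟨k, ?_, fun k' hk' => ?_⟩
        · have : k ∈ ({k} : Finset (Fin (n-1))) := by simp
          rw [← hk] at this; simpa using this
        · have : k' ∈ ({k} : Finset (Fin (n-1))) := by
            rw [← hk]; simpa using hk'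
          simpa using this
    · have hj' : idx2 j ∈ uraw n T k := by simpa [tR] using hj
      have := T.2.2.2 (idx2 j) k (by simp [idx2]) hj'
      simp [idx2] at this
      omega
  refine Finset.card_bij' (fun x _ => fun k => (x.val k).toLeft)
    (fun q hq => ⟨fun k => (q k).disjSum (tR n T k), (hL q hq).2⟩) ?_ ?_ ?_ ?_
  · intro x hx
    simp only [Finset.mem_filter, Finset.mem_univ, true_and] at hx
    rw [hP] at hx
    simp only [seqGood, Finset.mem_filter, Finset.mem_univ, true_and]
    refine ⟨fun k => (hx k).1, fun k k' hk => ?_, fun k => Finset.subset_univ _⟩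
    have := disj_of_unique _ x.2.2.1 k k' hk
    rw [Finset.disjoint_left] at this ⊢
    intro a h1 h2
    exact this (Finset.mem_toLeft.1 h1) (Finset.mem_toLeft.1 h2)
  · intro q hq
    simp only [Finset.mem_filter, Finset.mem_univ, true_and]
    exact (hL q hq).1
  · intro x hx
    simp only [Finset.mem_filter, Finset.mem_univ, true_and] at hx
    rw [hP] at hx
    apply Subtype.ext
    funext k
    simp only
    rw [← (hx k).2, Finset.toLeft_disjSum_toRight]
  · intro q hq
    funext k
    simp

theorem cherry_prod (n : ℕ) (hn : 3 ≤ n) (T : UCOM n) :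
    ∏ k ∈ Finset.range (n-1), (tS n T k).factorial = 2 ^ cherries n T := by
  have h0 : 0 < n - 1 := by omega
  rw [Finset.prod_range, cherries, ← Finset.prod_const, Finset.prod_filter]
  apply Finset.prod_congr rfl
  intro k _
  rw [← T_count_zero n T k h0]
  have hc : Multiset.card (uraw n T k) = 2 := T.2.1 k
  have hle := Multiset.count_le_card ⟨0, h0⟩ (uraw n T k)
  have hiff : (uraw n T k).count ⟨0, h0⟩ = 2 ↔ ∀ a ∈ uraw n T k, (a : ℕ) = 0 := by
    rw [← hc, Multiset.count_eq_card]
    refine forall_congr' fun a => forall_congr' fun _ => ?_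
    rw [Fin.ext_iff]; exact eq_comm
  rw [hc] at hle
  split_ifs with h
  · rw [hiff.2 h]; rfl
  · have : (uraw n T k).count ⟨0, h0⟩ ≠ 2 := fun h' => h (hiff.1 h')
    rw [Nat.factorial_eq_one]; omega

/-- For `n ≥ 3` and every unlabeled constrained ordered matching `T`, the
number of labeled constrained ordered matchings projecting to `T` equals `n!/2^{c(T)}`;
equivalently, the fraction of such matchings equals the Tajima probability
`2^{n−c(T)−1}/(n−1)!`. -/
theorem stmt7 (n : ℕ) (hn : 3 ≤ n) (T : UCOM n) :
    2 ^ cherries n T *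
      (Finset.univ.filter (fun x : LCOM n => projRaw n hn x.val = uraw n T)).card
      = Nat.factorial n ∧
    ((Finset.univ.filter (fun x : LCOM n => projRaw n hn x.val = uraw n T)).card : ℝ) /
        (Fintype.card (LCOM n) : ℝ)
      = tajima n T := by
  have h1 : 2 ^ cherries n T *
      (Finset.univ.filter (fun x : LCOM n => projRaw n hn x.val = uraw n T)).card
      = Nat.factorial n := by
    rw [fiber_card, seqGood_card _ (fun _ _ _ => le_rfl), ← cherry_prod n hn T]
    have := prod_choose_fact n (tS n T) (n-1) (tS_sum n hn T).le
    rw [tS_sum n hn T] at this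
    simpa using this
  refine ⟨h1, ?_⟩
  have h2 := card_LCOM n hn
  have hc : cherries n T ≤ n - 1 := by
    unfold cherries
    exact (Finset.card_le_univ _).trans (by simp)
  generalize (Finset.univ.filter (fun x : LCOM n => projRaw n hn x.val = uraw n T)).card = F at *
  generalize Fintype.card (LCOM n) = N at *
  unfold tajima
  generalize cherries n T = c at *
  have e : n - 1 = c + (n - c - 1) := by omega
  have hf : (0:ℝ) < n.factorial := by exact_mod_cast n.factorial_pos
  have hf' : (0:ℝ) < (n-1).factorial := by exact_mod_cast (n-1).factorial_pos
  have g1 : (2:ℝ) ^ c * F = n.factorial := by exact_mod_cast h1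
  have g2 : (2:ℝ) ^ (n-1) * N = n.factorial * (n-1).factorial := by exact_mod_cast h2
  have g3 : (2:ℝ) ^ (n-1) = 2 ^ c * 2 ^ (n-c-1) := by rw [← pow_add, ← e]
  have hN : (N:ℝ) ≠ 0 := by
    rintro h; rw [h, mul_zero] at g2
    exact (mul_pos hf hf').ne g2
  rw [div_eq_div_iff hN hf'.ne']
  have h2c : (2:ℝ)^c ≠ 0 := by positivity
  apply mul_left_cancel₀ h2c
  rw [g3] at g2
  linear_combination (((n-1).factorial : ℕ) : ℝ) * g1 - g2
end

section
/- Fix an integer n ≥ 3. Define the equivalence relation x ∼ x' on labeled constrained ordered matchings COM^L_n by: x ∼ x' if and only if they project to the same unlabeled constrained ordered matching when every leaf label is replaced by 0. Then for every x, x' ∈ COM^L_n with x ∼ x' and every equivalence class Ω of ∼, the adjacent-swap transition probabilities satisfy ∑_{y ∈ Ω} P^L(x,y) = ∑_{y ∈ Ω} P^L(x',y). -/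
open Finset

theorem lcom_uniq {n : ℕ} (x : LCOM n) {a : LLabel n} {i j : Fin (n - 1)}
    (hi : a ∈ x.val i) (hj : a ∈ x.val j) : i = j := by
  obtain ⟨k, _, h⟩ := x.2.2.1 a
  rw [h i hi, h j hj]

theorem mem_lswap {n : ℕ} (x : LCOM n) (k : Fin (n - 2)) {l1 l2 : LLabel n}
    (h1 : l1 ∈ x.val (idx1 k)) (h2 : l2 ∈ x.val (idx2 k)) (a : LLabel n) (i : Fin (n - 1)) :
    a ∈ lswapFun n x.val k l1 l2 i ↔
      (a = l1 ∧ i = idx2 k) ∨ (a = l2 ∧ i = idx1 k) ∨ (a ≠ l1 ∧ a ≠ l2 ∧ a ∈ x.val i) := by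
  have hne := idx_ne k
  have u1 : ∀ j, l1 ∈ x.val j → j = idx1 k := fun j hj => lcom_uniq x hj h1
  have u2 : ∀ j, l2 ∈ x.val j → j = idx2 k := fun j hj => lcom_uniq x hj h2
  have h12 : l1 ≠ l2 := by
    rintro rfl
    exact hne (u2 _ h1)
  unfold lswapFun
  by_cases hi1 : i = idx1 k
  · subst hi1
    simp only [if_true, Finset.mem_insert, Finset.mem_erase]
    grind
  · by_cases hi2 : i = idx2 k
    · subst hi2
      simp only [hi1, if_false, if_true, Finset.mem_insert, Finset.mem_erase]
      grind
    · simp only [hi1, hi2, if_false]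
      grind

theorem valid_iff {n : ℕ} (hn : 3 ≤ n) (x : LCOM n) (k : Fin (n - 2)) {l1 l2 : LLabel n}
    (h1 : l1 ∈ x.val (idx1 k)) (h2 : l2 ∈ x.val (idx2 k)) :
    IsLCOM n (lswapFun n x.val k l1 l2) ↔ (projLabel n hn l2 : ℕ) ≤ (k : ℕ) := by
  have hne := idx_ne k
  have n1 : l1 ∉ x.val (idx2 k) := fun h => hne (lcom_uniq x h1 h)
  have n2 : l2 ∉ x.val (idx1 k) := fun h => hne (lcom_uniq x h h2)
  have hm := mem_lswap x k h1 h2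
  constructor
  · intro h
    rcases l2 with l | j
    · simp [projLabel]
    · have := h.2.2 j (idx1 k) ((hm _ _).2 (Or.inr (Or.inl ⟨rfl, rfl⟩)))
      simp only [idx1] at this
      simp only [projLabel]
      omega
  · intro h
    refine ⟨?_, ?_, ?_⟩
    · intro i
      unfold lswapFun
      split_ifs with hi1 hi2
      · rw [Finset.card_insert_of_notMem (by simp [n2]), Finset.card_erase_of_mem h1, x.2.1]
      · rw [Finset.card_insert_of_notMem (by simp [n1]), Finset.card_erase_of_mem h2, x.2.1]
      · exact x.2.1 i
    · intro a
      obtain ⟨i, hi, hu⟩ := x.2.2.1 a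
      have h12 : l1 ≠ l2 := by
        rintro rfl
        exact n1 h2
      simp only [hm]
      by_cases ha1 : a = l1
      · exact ⟨idx2 k, by grind, by grind⟩
      · by_cases ha2 : a = l2
        · exact ⟨idx1 k, by grind, by grind⟩
        · exact ⟨i, by grind, by grind⟩
    · intro j i hj
      rcases (hm _ _).1 hj with ⟨e, rfl⟩ | ⟨e, rfl⟩ | ⟨_, _, h3⟩
      · subst e
        have := x.2.2.2 j _ h1
        simp only [idx1] at this
        simp only [idx2]
        omega
      · subst e
        simp only [projLabel] at h
        simp only [idx1]
        omega
      · exact x.2.2.2 j i h3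

/-- Destination of the unlabeled swap. -/
def uDest {n : ℕ} (q : Fin (n - 1) → Multiset (Fin (n - 1))) (k : Fin (n - 2))
    (a b : Fin (n - 1)) : Fin (n - 1) → Multiset (Fin (n - 1)) :=
  if (b : ℕ) ≤ (k : ℕ) then
    fun i => if i = idx1 k then b ::ₘ (q (idx1 k)).erase a
      else if i = idx2 k then a ::ₘ (q (idx2 k)).erase b
      else q i
  else q

theorem proj_dest {n : ℕ} (hn : 3 ≤ n) (x : LCOM n) (k : Fin (n - 2)) {l1 l2 : LLabel n}
    (h1 : l1 ∈ x.val (idx1 k)) (h2 : l2 ∈ x.val (idx2 k)) :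
    projRaw n hn (lswapDest n x k l1 l2)
      = uDest (projRaw n hn x.val) k (projLabel n hn l1) (projLabel n hn l2) := by
  have hne := idx_ne k
  have n1 : l1 ∉ x.val (idx2 k) := fun h => hne (lcom_uniq x h1 h)
  have n2 : l2 ∉ x.val (idx1 k) := fun h => hne (lcom_uniq x h h2)
  unfold lswapDest uDest
  simp only [valid_iff hn x k h1 h2]
  split_ifs with hv
  · funext i
    simp only [projRaw, lswapFun]
    split_ifs with hi1 hi2
    · rw [Finset.insert_val_of_notMem (by simp [n2]), Multiset.map_cons, Finset.erase_val,
        Multiset.map_erase_of_mem _ _ h1]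
    · rw [Finset.insert_val_of_notMem (by simp [n1]), Multiset.map_cons, Finset.erase_val,
        Multiset.map_erase_of_mem _ _ h2]
    · rfl
  · rfl

theorem dest_valid {n : ℕ} (x : LCOM n) (k : Fin (n - 2)) (l1 l2 : LLabel n) :
    IsLCOM n (lswapDest n x k l1 l2) := by
  unfold lswapDest
  split_ifs with h
  · exact h
  · exact x.2

theorem class_sum {n : ℕ} (hn : 3 ≤ n) (x z : LCOM n) :
    ∑ y ∈ Finset.univ.filter (fun y : LCOM n => projRaw n hn y.val = projRaw n hn z.val),
        PL n x y
      = (1 / ((n : ℝ) - 2)) * ∑ k : Fin (n - 2),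
        ((projRaw n hn x.val (idx1 k)).map fun a =>
          ((projRaw n hn x.val (idx2 k)).map fun b =>
            (1 / 4 : ℝ) * (if uDest (projRaw n hn x.val) k a b = projRaw n hn z.val
              then 1 else 0)).sum).sum := by
  unfold PL
  rw [← Finset.mul_sum, Finset.sum_comm]
  congr 1
  refine Finset.sum_congr rfl fun k _ => ?_
  rw [Finset.sum_comm]
  rw [show projRaw n hn x.val (idx1 k) = (x.val (idx1 k)).val.map (projLabel n hn) from rfl,
    Multiset.map_map]
  refine Finset.sum_congr rfl fun l1 h1 => ?_
  rw [Finset.sum_comm]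
  simp only [Function.comp]
  rw [show projRaw n hn x.val (idx2 k) = (x.val (idx2 k)).val.map (projLabel n hn) from rfl,
    Multiset.map_map]
  refine Finset.sum_congr rfl fun l2 h2 => ?_
  simp only [Function.comp]
  change _ = (1 / 4 : ℝ) * (if uDest (projRaw n hn x.val) k (projLabel n hn l1)
    (projLabel n hn l2) = projRaw n hn z.val then 1 else 0)
  rw [← proj_dest hn x k h1 h2, ← Finset.mul_sum]
  congr 1
  rw [Finset.sum_filter]
  rw [Finset.sum_eq_single (⟨_, dest_valid x k l1 l2⟩ : LCOM n)]
  · simp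
  · intro y _ hy
    have : lswapDest n x k l1 l2 ≠ y.val := fun h => hy (Subtype.ext h.symm)
    simp [this]
  · simp

/-- For `n ≥ 3`: if `x ∼ x'` (they project to the same unlabeled matching when
every leaf label is replaced by `0`), then for every equivalence class `Ω` of `∼`
(the class of an arbitrary `z`), `∑_{y ∈ Ω} P^L(x,y) = ∑_{y ∈ Ω} P^L(x',y)`. -/
theorem stmt8 (n : ℕ) (hn : 3 ≤ n) (x x' z : LCOM n)
    (hxx' : projRaw n hn x.val = projRaw n hn x'.val) :
    ∑ y ∈ Finset.univ.filter (fun y : LCOM n => projRaw n hn y.val = projRaw n hn z.val),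
        PL n x y
      = ∑ y ∈ Finset.univ.filter
          (fun y : LCOM n => projRaw n hn y.val = projRaw n hn z.val), PL n x' y := by
  rw [class_sum, class_sum, hxx']
end
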